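/- Let X be a Banach space and let Y₁, M, N, Y₂ be closed linear subspaces of X with Y₁ ⊆ M∩N ⊆ M+N ⊆ Y₂, M+N closed, dim((M∩N)/Y₁) infinite and dim(Y₂/(M+N)) finite. Then for every integer m there exists ε > 0 such that for every tetrad (Y₁′;M′,N′;Y₂′) of closed linear subspaces of X with Y₁′ ⊆ M′∩N′ ⊆ M′+N′ ⊆ Y₂′ and δ(Y₁′,Y₁) < ε, δ(M,M′) < ε, δ(N,N′) < ε, δ(Y₂′,Y₂) < ε, the subspace M′+N′ is closed, dim(Y₂′/(M′+N′)) is finite, and Index(Y₁′;M′,N′;Y₂′) ≥ m. -/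

import Mathlib

open scoped Classical

/-- The gap `δ(M,N)` between two linear subspaces of a normed space:
`δ(M,N) = sup_{u ∈ M, ‖u‖ = 1} dist(u, N)` (and `0` if `M = {0}`,
since the supremum of the empty set of reals is `0`). -/
noncomputable def gapSub {X : Type*} [NormedAddCommGroup X] [NormedSpace ℂ X]
    (M N : Submodule ℂ X) : ℝ :=
  sSup ((fun u => Metric.infDist u (N : Set X)) '' {u : X | u ∈ M ∧ ‖u‖ = 1})

/-- The symmetric gap `δ̂(M,N) = max (δ(M,N), δ(N,M))`. -/
noncomputable def hatGap {X : Type*} [NormedAddCommGroup X] [NormedSpace ℂ X]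
    (M N : Submodule ℂ X) : ℝ :=
  max (gapSub M N) (gapSub N M)

/-- The minimum gap `γ(M,N)`: the infimum of `dist(u,N)/dist(u, M ⊓ N)` over
`u ∈ M \ N`, and `1` if `M ⊆ N`. -/
noncomputable def minGap {X : Type*} [NormedAddCommGroup X] [NormedSpace ℂ X]
    (M N : Submodule ℂ X) : ℝ :=
  if M ≤ N then 1
  else sInf ((fun u => Metric.infDist u (N : Set X) /
      Metric.infDist u ((M ⊓ N : Submodule ℂ X) : Set X)) '' {u : X | u ∈ M ∧ u ∉ N})

/-- The rank (dimension, as a cardinal) of the quotient `B / A` for submodules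
`A ≤ B` of `X`. -/
noncomputable def quotRank {X : Type*} [NormedAddCommGroup X] [NormedSpace ℂ X]
    (A B : Submodule ℂ X) : Cardinal :=
  Module.rank ℂ (↥B ⧸ A.comap B.subtype)

/-- The quotient `B / A` is finite dimensional. -/
def QuotFin {X : Type*} [NormedAddCommGroup X] [NormedSpace ℂ X]
    (A B : Submodule ℂ X) : Prop :=
  FiniteDimensional ℂ (↥B ⧸ A.comap B.subtype)

/-- The finite dimension of the quotient `B / A`. -/
noncomputable def quotFinrank {X : Type*} [NormedAddCommGroup X] [NormedSpace ℂ X]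
    (A B : Submodule ℂ X) : ℕ :=
  Module.finrank ℂ (↥B ⧸ A.comap B.subtype)

/-- The dimension of the quotient `B / A` as an extended real:
the finrank if finite dimensional, `+∞` otherwise. -/
noncomputable def eQuotDim {X : Type*} [NormedAddCommGroup X] [NormedSpace ℂ X]
    (A B : Submodule ℂ X) : EReal :=
  if QuotFin A B then ((quotFinrank A B : ℝ) : EReal) else ⊤

/-- The index of a tetrad `(Y₁; M, N; Y₂)`:
`Index(Y₁; M, N; Y₂) = dim((M ∩ N)/Y₁) − dim(Y₂/(M + N))`, valued in `ℤ ∪ {±∞}`. -/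
noncomputable def tetradIndex {X : Type*} [NormedAddCommGroup X] [NormedSpace ℂ X]
    (Y₁ M N Y₂ : Submodule ℂ X) : EReal :=
  eQuotDim Y₁ (M ⊓ N) - eQuotDim (M ⊔ N) Y₂

section Helpers

variable {X : Type*} [NormedAddCommGroup X] [NormedSpace ℂ X]

lemma gap_approx {A B : Submodule ℂ X} {ε : ℝ} (h : gapSub A B < ε) {u : X} (hu : u ∈ A) :
    ∃ b ∈ B, ‖u - b‖ ≤ ε * ‖u‖ := by
  by_cases h0 : u = 0
  · exact ⟨0, B.zero_mem, by simp [h0]⟩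
  have hn : 0 < ‖u‖ := norm_pos_iff.2 h0
  set w : X := ((‖u‖⁻¹ : ℝ) : ℂ) • u with hw
  have hw1 : ‖w‖ = 1 := by
    rw [hw, norm_smul, Complex.norm_real, norm_inv, norm_norm, inv_mul_cancel₀ hn.ne']
  have hwA : w ∈ A := A.smul_mem _ hu
  have hlt : Metric.infDist w (B : Set X) < ε := by
    refine lt_of_le_of_lt ?_ h
    refine le_csSup ⟨1, ?_⟩ ⟨w, ⟨hwA, hw1⟩, rfl⟩
    rintro _ ⟨v, ⟨_, hv⟩, rfl⟩
    have := Metric.infDist_le_dist_of_mem (x := v) (s := (B : Set X)) B.zero_mem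
    simpa [hv] using this
  obtain ⟨b, hb, hd⟩ := (Metric.infDist_lt_iff ⟨0, B.zero_mem⟩).1 hlt
  refine ⟨((‖u‖ : ℝ) : ℂ) • b, B.smul_mem _ hb, ?_⟩
  have e : u - ((‖u‖ : ℝ) : ℂ) • b = ((‖u‖ : ℝ) : ℂ) • (w - b) := by
    rw [smul_sub, hw, smul_smul, ← Complex.ofReal_mul, mul_inv_cancel₀ hn.ne']
    simp
  rw [e, norm_smul, Complex.norm_real, norm_norm, mul_comm]
  rw [dist_eq_norm] at hd
  gcongr

/-- Successive approximation. -/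
lemma approx_surj {E : Type*} [NormedAddCommGroup E] [NormedSpace ℂ E] [CompleteSpace E]
    (T : E →L[ℂ] X) (Z : Submodule ℂ X) (hT : ∀ e, T e ∈ Z) (B : ℝ)
    (h : ∀ y ∈ Z, ∃ e, ‖e‖ ≤ B * ‖y‖ ∧ ‖y - T e‖ ≤ 1 / 2 * ‖y‖) :
    ∀ y ∈ Z, ∃ e, ‖e‖ ≤ 2 * B * ‖y‖ ∧ T e = y := by
  intro y hy
  choose! f hf1 hf2 using h
  let s : ℕ → X := fun n => (fun z => z - T (f z))^[n] y
  have s0 : s 0 = y := rfl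
  have ss : ∀ n, s (n + 1) = s n - T (f (s n)) := fun n =>
    Function.iterate_succ_apply' _ _ _
  have sZ : ∀ n, s n ∈ Z := by
    intro n
    induction n with
    | zero => exact hy
    | succ n ih => rw [ss]; exact Z.sub_mem ih (hT _)
  have sn : ∀ n, ‖s n‖ ≤ (1 / 2) ^ n * ‖y‖ := by
    intro n
    induction n with
    | zero => simp [s0]
    | succ n ih =>
      rw [ss]
      refine (hf2 _ (sZ n)).trans ?_
      rw [pow_succ]
      nlinarith
  by_cases hy0 : y = 0
  · exact ⟨0, by simp [hy0]⟩
  have hyp : 0 < ‖y‖ := norm_pos_iff.2 hy0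
  have hB : 0 ≤ B := by
    have := (norm_nonneg _).trans (hf1 y hy)
    by_contra hc
    nlinarith
  have un : ∀ n, ‖f (s n)‖ ≤ (1 / 2) ^ n * (B * ‖y‖) := by
    intro n
    refine (hf1 _ (sZ n)).trans ?_
    calc B * ‖s n‖ ≤ B * ((1 / 2) ^ n * ‖y‖) := by gcongr; exact sn n
      _ = _ := by ring
  have hg : HasSum (fun n : ℕ => (1 / 2 : ℝ) ^ n * (B * ‖y‖)) (2 * (B * ‖y‖)) :=
    hasSum_geometric_two.mul_right _
  have su : Summable (fun n => f (s n)) := .of_norm_bounded hg.summable un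
  refine ⟨∑' n, f (s n), ?_, ?_⟩
  · rw [mul_assoc]; exact tsum_of_norm_bounded hg un
  · have h1 : ∀ n : ℕ, T (∑ i ∈ Finset.range n, f (s i)) = y - s n := by
      intro n
      induction n with
      | zero => simp [s0]
      | succ n ih => rw [Finset.sum_range_succ, map_add, ih, ss]; abel
    have h2 : Filter.Tendsto (fun n : ℕ => T (∑ i ∈ Finset.range n, f (s i))) Filter.atTop
        (nhds (T (∑' n, f (s n)))) :=
      (T.continuous.tendsto _).comp su.hasSum.tendsto_sum_nat
    have h3 : Filter.Tendsto s Filter.atTop (nhds 0) := by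
      apply squeeze_zero_norm sn
      have := (tendsto_pow_atTop_nhds_zero_of_lt_one (r := (1 / 2 : ℝ)) (by norm_num)
        (by norm_num)).mul_const ‖y‖
      simpa using this
    have h4 : Filter.Tendsto (fun n : ℕ => y - s n) Filter.atTop (nhds (y - 0)) :=
      tendsto_const_nhds.sub h3
    simp_rw [h1] at h2
    simpa using tendsto_nhds_unique h2 h4

/-- The map `(m, n, c) ↦ m + n + ∑ c j • g j`. -/
noncomputable def sumMap (M N : Submodule ℂ X) {ι : Type*} [Fintype ι] (g : ι → X) :
    (M × N × (ι → ℂ)) →L[ℂ] X :=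
  M.subtypeL.coprod (N.subtypeL.coprod
    (LinearMap.toContinuousLinearMap (Fintype.linearCombination ℂ g)))

lemma sumMap_apply (M N : Submodule ℂ X) {ι : Type*} [Fintype ι] (g : ι → X)
    (e : M × N × (ι → ℂ)) :
    sumMap M N g e = (e.1 : X) + ((e.2.1 : X) + ∑ j, e.2.2 j • g j) := by
  simp [sumMap, Fintype.linearCombination_apply]

lemma sumMap_mem {M N Z : Submodule ℂ X} {ι : Type*} [Fintype ι] {g : ι → X}
    (hM : M ≤ Z) (hN : N ≤ Z) (hg : ∀ j, g j ∈ Z) (e : M × N × (ι → ℂ)) :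
    sumMap M N g e ∈ Z := by
  rw [sumMap_apply]
  exact Z.add_mem (hM e.1.2) (Z.add_mem (hN e.2.1.2)
    (Z.sum_mem fun j _ => Z.smul_mem _ (hg j)))

/-- From approximation by finitely many outside points to a uniformly bounded right inverse. -/
lemma uniform_surj [CompleteSpace X] {M N Z : Submodule ℂ X} (hMc : IsClosed (M : Set X))
    (hNc : IsClosed (N : Set X)) (hM : M ≤ Z) (hN : N ≤ Z) {ι : Type*} [Fintype ι]
    (p : ι → X) (B : ℝ) (hB : 1 ≤ B)
    (h : ∀ y ∈ Z, ‖y‖ = 1 → ∃ m ∈ M, ∃ n ∈ N, ∃ j, ‖m‖ ≤ B ∧ ‖n‖ ≤ B ∧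
      ‖y - m - n - p j‖ ≤ 1 / 4) :
    ∃ g : ι → X, (∀ j, g j ∈ Z) ∧ ∀ y ∈ Z, ∃ e : M × N × (ι → ℂ),
      ‖e‖ ≤ 4 * B * ‖y‖ ∧ sumMap M N g e = y := by
  have hsel : ∀ j : ι, ∃ g m n : X, g ∈ Z ∧ m ∈ M ∧ n ∈ N ∧ ‖m‖ ≤ B ∧ ‖n‖ ≤ B ∧
      ((∃ y ∈ Z, ‖y‖ = 1 ∧ ∃ m ∈ M, ∃ n ∈ N, ‖m‖ ≤ B ∧ ‖n‖ ≤ B ∧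
      ‖y - m - n - p j‖ ≤ 1 / 4) → ‖g - m - n - p j‖ ≤ 1 / 4) := by
    intro j
    by_cases hj : ∃ y ∈ Z, ‖y‖ = 1 ∧ ∃ m ∈ M, ∃ n ∈ N, ‖m‖ ≤ B ∧ ‖n‖ ≤ B ∧
      ‖y - m - n - p j‖ ≤ 1 / 4
    · obtain ⟨y, hy, _, m, hm, n, hn, h1, h2, h3⟩ := hj
      exact ⟨y, m, n, hy, hm, hn, h1, h2, fun _ => h3⟩
    · exact ⟨0, 0, 0, Z.zero_mem, M.zero_mem, N.zero_mem, by simp; linarith, by simp; linarith,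
        fun h => absurd h hj⟩
  choose g m₀ n₀ hg hm₀ hn₀ bm₀ bn₀ hclose using hsel
  refine ⟨g, hg, ?_⟩
  have : CompleteSpace M := hMc.completeSpace_coe
  have : CompleteSpace N := hNc.completeSpace_coe
  have key := approx_surj (sumMap M N g) Z (sumMap_mem hM hN hg) (2 * B) ?_
  · intro y hy
    obtain ⟨e, he, h'⟩ := key y hy
    exact ⟨e, he.trans (le_of_eq (by ring)), h'⟩
  intro y hy
  by_cases h0 : y = 0
  · exact ⟨0, by simp [h0]⟩
  have hn : 0 < ‖y‖ := norm_pos_iff.2 h0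
  set w : X := ((‖y‖⁻¹ : ℝ) : ℂ) • y with hw
  have hw1 : ‖w‖ = 1 := by
    rw [hw, norm_smul, Complex.norm_real, norm_inv, norm_norm, inv_mul_cancel₀ hn.ne']
  have hyw : y = ((‖y‖ : ℝ) : ℂ) • w := by
    rw [hw, smul_smul, ← Complex.ofReal_mul, mul_inv_cancel₀ hn.ne']
    simp
  have hwZ : w ∈ Z := Z.smul_mem _ hy
  obtain ⟨m, hm, n, hn', j, bm, bn, hj⟩ := h w hwZ hw1
  have hgj := hclose j ⟨w, hwZ, hw1, m, hm, n, hn', bm, bn, hj⟩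
  let e : M × N × (ι → ℂ) :=
    (⟨m - m₀ j, M.sub_mem hm (hm₀ j)⟩, ⟨n - n₀ j, N.sub_mem hn' (hn₀ j)⟩, Pi.single j 1)
  have hTe : sumMap M N g e = (m - m₀ j) + ((n - n₀ j) + g j) := by
    rw [sumMap_apply]
    simp [e, Pi.single_apply, ite_smul]
  have he : ‖e‖ ≤ 2 * B := by
    refine max_le ?_ (max_le ?_ ?_)
    · show ‖m - m₀ j‖ ≤ _
      linarith [norm_sub_le m (m₀ j), bm₀ j]
    · show ‖n - n₀ j‖ ≤ _
      linarith [norm_sub_le n (n₀ j), bn₀ j]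
    · show ‖(Pi.single j 1 : ι → ℂ)‖ ≤ _
      rw [Pi.norm_single]
      simp; linarith
  refine ⟨((‖y‖ : ℝ) : ℂ) • e, ?_, ?_⟩
  · rw [norm_smul, Complex.norm_real, norm_norm, mul_comm]
    gcongr
  · have e2 : y - sumMap M N g (((‖y‖ : ℝ) : ℂ) • e)
        = ((‖y‖ : ℝ) : ℂ) • ((w - m - n - p j) - (g j - m₀ j - n₀ j - p j)) := by
      rw [map_smul, hTe]
      have e3 : ((w - m - n - p j) - (g j - m₀ j - n₀ j - p j))
          = w - ((m - m₀ j) + ((n - n₀ j) + g j)) := by abel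
      rw [e3, smul_sub, ← hyw]
    rw [e2, norm_smul, Complex.norm_real, norm_norm, mul_comm]
    have := norm_sub_le (w - m - n - p j) (g j - m₀ j - n₀ j - p j)
    gcongr
    linarith

/-- Closedness of `M + N` from surjectivity. -/
lemma closed_of_surj [CompleteSpace X] {M N Z : Submodule ℂ X} (hMc : IsClosed (M : Set X))
    (hNc : IsClosed (N : Set X)) (hZc : IsClosed (Z : Set X)) (hM : M ≤ Z) (hN : N ≤ Z)
    {ι : Type*} [Fintype ι] {g : ι → X} (hg : ∀ j, g j ∈ Z)
    (h : ∀ y ∈ Z, ∃ e : M × N × (ι → ℂ), sumMap M N g e = y) :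
    IsClosed ((M ⊔ N : Submodule ℂ X) : Set X) := by
  have : CompleteSpace M := hMc.completeSpace_coe
  have : CompleteSpace N := hNc.completeSpace_coe
  have : CompleteSpace Z := hZc.completeSpace_coe
  let T : (M × N × (ι → ℂ)) →L[ℂ] Z := (sumMap M N g).codRestrict Z (sumMap_mem hM hN hg)
  have hT : Function.Surjective T := by
    rintro ⟨y, hy⟩
    obtain ⟨e, he⟩ := h y hy
    exact ⟨e, Subtype.ext he⟩
  have hq : Topology.IsQuotientMap T := (T.isOpenMap hT).isQuotientMap T.continuous hT
  have hcl : IsClosed ((Subtype.val : Z → X) ⁻¹' ((M ⊔ N : Submodule ℂ X) : Set X)) := by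
    rw [← hq.isClosed_preimage]
    let W : Submodule ℂ (ι → ℂ) := (M ⊔ N).comap (Fintype.linearCombination ℂ g)
    have hW : IsClosed (W : Set (ι → ℂ)) := W.closed_of_finiteDimensional
    have : T ⁻¹' ((Subtype.val : Z → X) ⁻¹' ((M ⊔ N : Submodule ℂ X) : Set X))
        = (fun e : M × N × (ι → ℂ) => e.2.2) ⁻¹' (W : Set (ι → ℂ)) := by
      ext e
      show sumMap M N g e ∈ M ⊔ N ↔ Fintype.linearCombination ℂ g e.2.2 ∈ M ⊔ N
      rw [sumMap_apply, Fintype.linearCombination_apply,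
        Submodule.add_mem_iff_right _ (Submodule.mem_sup_left e.1.2),
        Submodule.add_mem_iff_right _ (Submodule.mem_sup_right e.2.1.2)]
    rw [this]
    exact hW.preimage (by fun_prop)
  have := (hZc.isClosedEmbedding_subtypeVal.isClosedMap _ hcl)
  have e4 : (Subtype.val : Z → X) '' ((Subtype.val : Z → X) ⁻¹'
      ((M ⊔ N : Submodule ℂ X) : Set X)) = ((M ⊔ N : Submodule ℂ X) : Set X) := by
    ext z
    constructor
    · rintro ⟨w, hw, rfl⟩
      exact hw
    · intro hz
      exact ⟨⟨z, sup_le hM hN hz⟩, hz, rfl⟩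
  exact e4 ▸ this

/-- Finite codimension from surjectivity. -/
lemma quotFin_of_surj {M N Z : Submodule ℂ X}
    {ι : Type*} [Fintype ι] {g : ι → X} (hg : ∀ j, g j ∈ Z)
    (hM : M ≤ Z) (hN : N ≤ Z)
    (h : ∀ y ∈ Z, ∃ e : M × N × (ι → ℂ), sumMap M N g e = y) :
    QuotFin (M ⊔ N) Z ∧ quotFinrank (M ⊔ N) Z ≤ Fintype.card ι := by
  let v : ι → (↥Z ⧸ (M ⊔ N).comap Z.subtype) := fun j => Submodule.Quotient.mk ⟨g j, hg j⟩
  have hs : Function.Surjective (Fintype.linearCombination ℂ v) := by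
    intro q
    obtain ⟨⟨y, hy⟩, rfl⟩ := Submodule.Quotient.mk_surjective _ q
    obtain ⟨e, he⟩ := h y hy
    refine ⟨e.2.2, ?_⟩
    have : Fintype.linearCombination ℂ v e.2.2 = Submodule.Quotient.mk
        (∑ j, e.2.2 j • (⟨g j, hg j⟩ : Z)) := by
      rw [Fintype.linearCombination_apply, ← Submodule.mkQ_apply, map_sum]
      simp only [map_smul, Submodule.mkQ_apply, v]
    rw [this, eq_comm, Submodule.Quotient.eq, Submodule.mem_comap]
    have e3 : Z.subtype (⟨y, hy⟩ - ∑ j, e.2.2 j • (⟨g j, hg j⟩ : Z)) = (e.1 : X) + e.2.1 := by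
      rw [map_sub, map_sum]
      simp only [map_smul, Submodule.subtype_apply]
      rw [← he, sumMap_apply]
      abel
    rw [e3]
    exact Submodule.add_mem_sup e.1.2 e.2.1.2
  refine ⟨Module.Finite.of_surjective _ hs, ?_⟩
  have := LinearMap.finrank_range_le (Fintype.linearCombination ℂ v)
  rw [LinearMap.range_eq_top.2 hs, finrank_top] at this
  simpa [quotFinrank] using this

/-- The initial decomposition. -/
lemma init_surj [CompleteSpace X] {M N Z : Submodule ℂ X} (hMc : IsClosed (M : Set X))
    (hNc : IsClosed (N : Set X)) (hZc : IsClosed (Z : Set X)) (h : M ⊔ N ≤ Z)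
    (hfin : QuotFin (M ⊔ N) Z) :
    ∃ (d : ℕ) (b : Fin d → X) (C : ℝ), 1 ≤ C ∧ ∀ y ∈ Z, ∃ e : M × N × (Fin d → ℂ),
      ‖e‖ ≤ C * ‖y‖ ∧ sumMap M N b e = y := by
  have : CompleteSpace M := hMc.completeSpace_coe
  have : CompleteSpace N := hNc.completeSpace_coe
  have : CompleteSpace Z := hZc.completeSpace_coe
  have : Module.Finite ℂ (↥Z ⧸ (M ⊔ N).comap Z.subtype) := hfin
  obtain ⟨d, s, hs⟩ := Module.Finite.exists_fin (R := ℂ) (M := ↥Z ⧸ (M ⊔ N).comap Z.subtype)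
  choose b hb using fun i => Submodule.Quotient.mk_surjective _ (s i)
  refine ⟨d, fun i => (b i : X), ?_⟩
  let T : (M × N × (Fin d → ℂ)) →L[ℂ] Z := (sumMap M N fun i => (b i : X)).codRestrict Z
    (sumMap_mem (le_sup_left.trans h) (le_sup_right.trans h) fun i => (b i).2)
  have hT : Function.Surjective T := by
    intro y
    have : (Submodule.Quotient.mk y : ↥Z ⧸ (M ⊔ N).comap Z.subtype) ∈
        Submodule.span ℂ (Set.range s) := by rw [hs]; trivial
    obtain ⟨c, hc⟩ := (Submodule.mem_span_range_iff_exists_fun ℂ).1 this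
    have e1 : (Submodule.Quotient.mk y : ↥Z ⧸ (M ⊔ N).comap Z.subtype) =
        Submodule.Quotient.mk (∑ i, c i • b i) := by
      rw [← hc, ← Submodule.mkQ_apply _ (∑ i, c i • b i), map_sum]
      simp [hb]
    rw [Submodule.Quotient.eq, Submodule.mem_comap] at e1
    obtain ⟨m, hm, n, hn, hmn⟩ := Submodule.mem_sup.1 e1
    refine ⟨(⟨m, hm⟩, ⟨n, hn⟩, c), Subtype.ext ?_⟩
    show sumMap M N _ _ = _
    rw [sumMap_apply]
    simp only
    rw [← add_assoc, hmn]
    simp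
  obtain ⟨C, hC, hT'⟩ := T.exists_preimage_norm_le hT
  refine ⟨max C 1, le_max_right _ _, fun y hy => ?_⟩
  obtain ⟨e, he, hn⟩ := hT' ⟨y, hy⟩
  refine ⟨e, hn.trans ?_, congrArg Subtype.val he⟩
  show C * ‖y‖ ≤ _
  gcongr
  exact le_max_left _ _

/-- Uniform data for nearby subspaces. -/
lemma uniform_data [CompleteSpace X] {M N Z : Submodule ℂ X} (hMc : IsClosed (M : Set X))
    (hNc : IsClosed (N : Set X)) (hZc : IsClosed (Z : Set X)) (h : M ⊔ N ≤ Z)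
    (hfin : QuotFin (M ⊔ N) Z) :
    ∃ (K : ℕ) (B ε₀ : ℝ), 0 ≤ B ∧ 0 < ε₀ ∧ ∀ ε ≤ ε₀, ∀ M' N' Z' : Submodule ℂ X,
      IsClosed (M' : Set X) → IsClosed (N' : Set X) → M' ≤ Z' → N' ≤ Z' →
      gapSub M M' < ε → gapSub N N' < ε → gapSub Z' Z < ε →
      ∃ g : Fin K → X, (∀ j, g j ∈ Z') ∧ ∀ y ∈ Z', ∃ e : M' × N' × (Fin K → ℂ),
      ‖e‖ ≤ B * ‖y‖ ∧ sumMap M' N' g e = y := by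
  obtain ⟨d, b, C, hC, hdec⟩ := init_surj hMc hNc hZc h hfin
  let L := LinearMap.toContinuousLinearMap (Fintype.linearCombination ℂ b)
  have hcpt : IsCompact (L '' Metric.closedBall 0 (2 * C)) :=
    (isCompact_closedBall _ _).image L.continuous
  obtain ⟨t, ht, hcov⟩ := Metric.totallyBounded_iff.1 hcpt.totallyBounded (1 / 8) (by norm_num)
  have : Fintype t := ht.fintype
  let eq := Fintype.equivFin t
  refine ⟨Fintype.card t, 4 * (4 * C), 1 / (40 * C), by positivity, by positivity, ?_⟩
  intro ε hε M' N' Z' hM'c hN'c hM' hN' gM gN gZ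
  refine uniform_surj hM'c hN'c hM' hN' (fun i => ((eq.symm i : t) : X)) (4 * C) (by linarith) ?_
  intro y' hy' hy1
  have hεC : ε * C ≤ 1 / 40 := by
    rw [le_div_iff₀ (by positivity)] at hε
    linarith
  have hε1 : ε ≤ 1 := hε.trans (by rw [div_le_one (by positivity)]; linarith)
  obtain ⟨y, hy, hyd⟩ := gap_approx gZ hy'
  rw [hy1, mul_one] at hyd
  have hε0 : 0 ≤ ε := (norm_nonneg _).trans hyd
  have hyn : ‖y‖ ≤ 2 := by
    have : y = y' - (y' - y) := by abel
    rw [this]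
    linarith [norm_sub_le y' (y' - y)]
  obtain ⟨e, he, hey⟩ := hdec y hy
  have heC : ‖e‖ ≤ 2 * C := by nlinarith
  have n1 : ‖(e.1 : X)‖ ≤ 2 * C := (norm_fst_le e).trans heC
  have n2 : ‖(e.2.1 : X)‖ ≤ 2 * C := (norm_fst_le e.2).trans ((norm_snd_le e).trans heC)
  have n3 : ‖e.2.2‖ ≤ 2 * C := (norm_snd_le e.2).trans ((norm_snd_le e).trans heC)
  obtain ⟨m, hm, hmd⟩ := gap_approx gM e.1.2
  obtain ⟨n, hn, hnd⟩ := gap_approx gN e.2.1.2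
  have hmd' : ‖(e.1 : X) - m‖ ≤ 2 * (ε * C) := hmd.trans (by nlinarith)
  have hnd' : ‖(e.2.1 : X) - n‖ ≤ 2 * (ε * C) := hnd.trans (by nlinarith)
  have hmem : L e.2.2 ∈ L '' Metric.closedBall 0 (2 * C) :=
    ⟨_, by simpa using n3, rfl⟩
  obtain ⟨q, hq, hqd⟩ := Set.mem_iUnion₂.1 (hcov hmem)
  refine ⟨m, hm, n, hn, eq ⟨q, hq⟩, ?_, ?_, ?_⟩
  · have : m = e.1 - (e.1 - m) := by abel
    rw [this]
    linarith [norm_sub_le (e.1 : X) (e.1 - m)]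
  · have : n = e.2.1 - (e.2.1 - n) := by abel
    rw [this]
    linarith [norm_sub_le (e.2.1 : X) (e.2.1 - n)]
  · simp only [Equiv.symm_apply_apply]
    rw [Metric.mem_ball, dist_eq_norm] at hqd
    have hLe : L e.2.2 = ∑ j, e.2.2 j • b j := by
      simp [L, Fintype.linearCombination_apply]
    rw [sumMap_apply, ← hLe] at hey
    have : y' - m - n - q = (y' - y) + (e.1 - m) + (e.2.1 - n) + (L e.2.2 - q) := by
      rw [← hey]; abel
    rw [this]
    have hεε : ε ≤ ε * C := by nlinarith
    linarith [norm_add_le ((y' - y) + ((e.1 : X) - m) + (e.2.1 - n)) (L e.2.2 - q),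
      norm_add_le ((y' - y) + ((e.1 : X) - m)) (e.2.1 - n),
      norm_add_le (y' - y) ((e.1 : X) - m)]

/-- Many vectors independent modulo `Y`, quantitatively. -/
lemma indep_data {Y W : Submodule ℂ X} (hYc : IsClosed (Y : Set X)) (hinf : ¬ QuotFin Y W)
    (L : ℕ) : ∃ (x : Fin L → X) (c : ℝ), 0 < c ∧ (∀ i, x i ∈ W) ∧
      ∀ a : Fin L → ℂ, ∀ y ∈ Y, c * ‖a‖ ≤ ‖∑ i, a i • x i - y‖ := by
  have hr : (L : Cardinal) ≤ Module.rank ℂ (↥W ⧸ Y.comap W.subtype) := by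
    have : Cardinal.aleph0 ≤ Module.rank ℂ (↥W ⧸ Y.comap W.subtype) := by
      by_contra hc
      exact hinf (Module.rank_lt_aleph0_iff.1 (not_le.1 hc))
    exact Cardinal.natCast_le_aleph0.trans this
  obtain ⟨s, hs⟩ := exists_linearIndependent_of_le_rank hr
  choose x hx using fun i => Submodule.Quotient.mk_surjective _ (s i)
  have : IsClosed (Y : Set X) := hYc
  let f : (Fin L → ℂ) →ₗ[ℂ] (X ⧸ Y) := Y.mkQ ∘ₗ Fintype.linearCombination ℂ (fun i => (x i : X))
  have hf : LinearMap.ker f = ⊥ := by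
    rw [LinearMap.ker_eq_bot']
    intro a ha
    have ha' : ∑ i, a i • (x i : X) ∈ Y := by
      simpa [f, Fintype.linearCombination_apply, -map_sum] using ha
    have h0 : ∑ i, a i • s i = 0 := by
      have : ∑ i, a i • s i = ((Y.comap W.subtype).mkQ (∑ i, a i • x i)) := by
        rw [map_sum]; simp [hx]
      rw [this, Submodule.mkQ_apply, Submodule.Quotient.mk_eq_zero, Submodule.mem_comap]
      simpa using ha'
    funext i
    exact Fintype.linearIndependent_iff.1 hs a h0 i
  obtain ⟨K, hK, hanti⟩ := f.exists_antilipschitzWith hf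
  have hK' : (0 : ℝ) < K := hK
  refine ⟨fun i => (x i : X), (K : ℝ)⁻¹, by positivity, fun i => (x i).2, fun a y hy => ?_⟩
  have h1 : ‖a‖ ≤ K * ‖f a‖ := by
    have := hanti.le_mul_dist a 0
    simpa using this
  have h2 : f a = Submodule.Quotient.mk (∑ i, a i • (x i : X) - y) := by
    have : f a = Submodule.Quotient.mk (∑ i, a i • (x i : X)) := by
      simp only [f, LinearMap.comp_apply, Fintype.linearCombination_apply, Submodule.mkQ_apply]
    rw [this, Submodule.Quotient.eq]
    simpa using hy
  have h3 : ‖f a‖ ≤ ‖∑ i, a i • (x i : X) - y‖ := by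
    rw [h2]; exact Submodule.Quotient.norm_mk_le _ _
  rw [inv_mul_le_iff₀ hK']
  exact h1.trans (by gcongr)

lemma norm_comb_le {L : ℕ} (a : Fin L → ℂ) (v : Fin L → X) {R : ℝ} (hv : ∀ i, ‖v i‖ ≤ R) :
    ‖∑ i, a i • v i‖ ≤ L * R * ‖a‖ := by
  calc ‖∑ i, a i • v i‖ ≤ ∑ i : Fin L, ‖a‖ * R := by
        refine norm_sum_le_of_le _ fun i _ => ?_
        rw [norm_smul]
        gcongr
        · exact norm_le_pi_norm a i
        · exact hv i
    _ = _ := by simp; ring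

/-- Lower bound on the dimension of the perturbed intersection quotient. -/
lemma inter_lower {M N Y : Submodule ℂ X} {L K : ℕ} (x : Fin L → X) (c B R : ℝ) (hB : 0 ≤ B)
    (hR : 0 ≤ R) (hx : ∀ i, x i ∈ M ⊓ N) (hxR : ∀ i, ‖x i‖ ≤ R)
    (hc : ∀ a : Fin L → ℂ, ∀ y ∈ Y, c * ‖a‖ ≤ ‖∑ i, a i • x i - y‖)
    (ε : ℝ) (hε0 : 0 < ε) (hε1 : ε ≤ 1) (hεc : ε * (L * R * (3 + 4 * B)) < c)
    {Y' M' N' Z' : Submodule ℂ X} (hM' : M' ≤ Z') (hN' : N' ≤ Z')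
    (gY : gapSub Y' Y < ε) (gM : gapSub M M' < ε) (gN : gapSub N N' < ε)
    (g : Fin K → X) (hg : ∀ y ∈ Z', ∃ e : M' × N' × (Fin K → ℂ),
      ‖e‖ ≤ B * ‖y‖ ∧ sumMap M' N' g e = y) (hfin : QuotFin Y' (M' ⊓ N')) :
    L ≤ quotFinrank Y' (M' ⊓ N') + K := by
  choose m hm hmd using fun i => gap_approx gM (hx i).1
  choose n hn hnd using fun i => gap_approx gN (hx i).2
  have hmd' : ∀ i, ‖x i - m i‖ ≤ ε * R := fun i => (hmd i).trans (by gcongr; exact hxR i)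
  have hnd' : ∀ i, ‖x i - n i‖ ≤ ε * R := fun i => (hnd i).trans (by gcongr; exact hxR i)
  choose e heB he using fun i => hg (m i - n i) (Z'.sub_mem (hM' (hm i)) (hN' (hn i)))
  let u : Fin L → X := fun i => m i - (e i).1
  have huM : ∀ i, u i ∈ M' := fun i => M'.sub_mem (hm i) (e i).1.2
  have hu2 : ∀ i, u i = (n i + (e i).2.1) + ∑ j, (e i).2.2 j • g j := by
    intro i
    have := he i
    rw [sumMap_apply] at this
    have h2 : m i = (m i - n i) + n i := by abel
    simp only [u]
    rw [h2, ← this]; abel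
  have hux : ∀ i, ‖u i - x i‖ ≤ ε * R * (1 + 2 * B) := by
    intro i
    have h1 : ‖m i - n i‖ ≤ 2 * (ε * R) := by
      have : m i - n i = (x i - n i) - (x i - m i) := by abel
      rw [this]
      linarith [norm_sub_le (x i - n i) (x i - m i), hmd' i, hnd' i]
    have h2 : ‖((e i).1 : X)‖ ≤ B * (2 * (ε * R)) :=
      (norm_fst_le (e i)).trans ((heB i).trans (by gcongr))
    have h3 : u i - x i = -((x i - m i) + (e i).1) := by simp only [u]; abel
    rw [h3, norm_neg]
    linarith [norm_add_le (x i - m i) ((e i).1 : X), hmd' i]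
  let Ct : (Fin L → ℂ) →ₗ[ℂ] (Fin K → ℂ) := Fintype.linearCombination ℂ (fun i => (e i).2.2)
  let U : (Fin L → ℂ) →ₗ[ℂ] X := Fintype.linearCombination ℂ u
  have hU : ∀ a ∈ LinearMap.ker Ct, U a ∈ M' ⊓ N' := by
    intro a ha
    have ha' : ∑ i, a i • (e i).2.2 = 0 := by
      simpa [Ct, Fintype.linearCombination_apply] using ha
    have hUa : U a = ∑ i, a i • u i := by simp [U, Fintype.linearCombination_apply]
    refine ⟨?_, ?_⟩
    · rw [hUa]; exact M'.sum_mem fun i _ => M'.smul_mem _ (huM i)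
    · have : ∑ i, a i • ∑ j, (e i).2.2 j • g j = 0 := by
        simp_rw [Finset.smul_sum, smul_smul]
        rw [Finset.sum_comm]
        refine Finset.sum_eq_zero fun j _ => ?_
        rw [← Finset.sum_smul]
        have := congrFun ha' j
        simp only [Finset.sum_apply, Pi.smul_apply, smul_eq_mul, Pi.zero_apply] at this
        rw [this, zero_smul]
      rw [hUa]
      simp_rw [hu2, smul_add _ (n _ + _), Finset.sum_add_distrib]
      rw [this, add_zero]
      exact N'.sum_mem fun i _ => N'.smul_mem _ (N'.add_mem (hn i) (e i).2.1.2)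
  let V : LinearMap.ker Ct →ₗ[ℂ] (↥(M' ⊓ N') ⧸ Y'.comap (M' ⊓ N').subtype) :=
    (Y'.comap (M' ⊓ N').subtype).mkQ ∘ₗ
      (LinearMap.codRestrict (M' ⊓ N') (U ∘ₗ (LinearMap.ker Ct).subtype) fun a => hU a a.2)
  have hV : Function.Injective V := by
    rw [← LinearMap.ker_eq_bot, LinearMap.ker_eq_bot']
    rintro ⟨a, ha⟩ h0
    have hY : U a ∈ Y' := by
      simp only [V, LinearMap.comp_apply, Submodule.mkQ_apply, Submodule.Quotient.mk_eq_zero,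
        Submodule.mem_comap] at h0
      exact h0
    have hUa : U a = ∑ i, a i • u i := by simp [U, Fintype.linearCombination_apply]
    rw [hUa] at hY
    obtain ⟨y, hy, hyd⟩ := gap_approx gY hY
    have h1 := hc a y hy
    have h2 : ‖∑ i, a i • (u i - x i)‖ ≤ L * (ε * R * (1 + 2 * B)) * ‖a‖ := norm_comb_le a _ hux
    have h3 : ‖∑ i, a i • x i‖ ≤ L * R * ‖a‖ := norm_comb_le a _ hxR
    have h4 : ∑ i, a i • (u i - x i) = ∑ i, a i • u i - ∑ i, a i • x i := by
      simp [smul_sub]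
    rw [h4] at h2
    have h5 := norm_add_le (∑ i, a i • u i - ∑ i, a i • x i) (∑ i, a i • x i)
    rw [sub_add_cancel] at h5
    have h6 := norm_sub_le (∑ i, a i • u i - y) (∑ i, a i • u i - ∑ i, a i • x i)
    have h7 : (∑ i, a i • u i - y) - (∑ i, a i • u i - ∑ i, a i • x i) = ∑ i, a i • x i - y := by
      abel
    rw [h7] at h6
    set t := (L : ℝ) * R * ‖a‖ with ht
    have ht0 : 0 ≤ t := by positivity
    have h8 : (L : ℝ) * (ε * R * (1 + 2 * B)) * ‖a‖ = ε * ((1 + 2 * B) * t) := by rw [ht]; ring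
    rw [h8] at h2
    have hq : ε * ((1 + 2 * B) * t) ≤ 1 * ((1 + 2 * B) * t) := by gcongr
    have h9 : ‖∑ i, a i • u i‖ ≤ (2 + 2 * B) * t := by linarith
    have h10 : ε * ‖∑ i, a i • u i‖ ≤ ε * ((2 + 2 * B) * t) := by gcongr
    have h11 : c * ‖a‖ ≤ ε * (L * R * (3 + 4 * B)) * ‖a‖ := by
      have : ε * (L * R * (3 + 4 * B)) * ‖a‖ = ε * ((1 + 2 * B) * t) + ε * ((2 + 2 * B) * t) := by
        rw [ht]; ring
      rw [this]; linarith
    have h12 : ‖a‖ = 0 := by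
      by_contra hne
      have : 0 < ‖a‖ := lt_of_le_of_ne (norm_nonneg _) (Ne.symm hne)
      nlinarith
    exact Subtype.ext (norm_eq_zero.1 h12)
  have : FiniteDimensional ℂ (↥(M' ⊓ N') ⧸ Y'.comap (M' ⊓ N').subtype) := hfin
  have r1 := LinearMap.finrank_le_finrank_of_injective hV
  have r2 := LinearMap.finrank_range_add_finrank_ker Ct
  have r3 := Submodule.finrank_le (LinearMap.range Ct)
  simp only [Module.finrank_fintype_fun_eq_card, Fintype.card_fin] at r2 r3
  unfold quotFinrank
  omega

end Helpers

/-- If `dim((M ∩ N)/Y₁) = ∞` and `dim(Y₂/(M+N)) < ∞`, then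
for every integer `m`, every nearby tetrad (in the one-sided gaps) has
`M' + N'` closed, `dim(Y₂'/(M'+N')) < ∞`, and index at least `m`. -/
theorem stable_tetrad_index_unbounded {X : Type*} [NormedAddCommGroup X]
    [NormedSpace ℂ X] [CompleteSpace X] (Y₁ M N Y₂ : Submodule ℂ X)
    (hY₁c : IsClosed (Y₁ : Set X)) (hMc : IsClosed (M : Set X))
    (hNc : IsClosed (N : Set X)) (hY₂c : IsClosed (Y₂ : Set X))
    (hMNc : IsClosed ((M ⊔ N : Submodule ℂ X) : Set X))
    (h₁ : Y₁ ≤ M ⊓ N) (h₂ : M ⊔ N ≤ Y₂)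
    (hinf : ¬ QuotFin Y₁ (M ⊓ N)) (hfin : QuotFin (M ⊔ N) Y₂) :
    ∀ m : ℤ, ∃ ε > (0 : ℝ), ∀ Y₁' M' N' Y₂' : Submodule ℂ X,
      IsClosed (Y₁' : Set X) → IsClosed (M' : Set X) → IsClosed (N' : Set X) →
      IsClosed (Y₂' : Set X) →
      Y₁' ≤ M' ⊓ N' → M' ⊔ N' ≤ Y₂' →
      gapSub Y₁' Y₁ < ε → gapSub M M' < ε → gapSub N N' < ε → gapSub Y₂' Y₂ < ε →
      IsClosed ((M' ⊔ N' : Submodule ℂ X) : Set X) ∧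
        QuotFin (M' ⊔ N') Y₂' ∧
        ((m : ℝ) : EReal) ≤ tetradIndex Y₁' M' N' Y₂' := by
  intro m
  obtain ⟨K, B, ε₀, hB, hε₀, hdata⟩ := uniform_data hMc hNc hY₂c h₂ hfin
  obtain ⟨L, hL⟩ : ∃ L : ℕ, L = m.toNat + 2 * K := ⟨_, rfl⟩
  obtain ⟨x, c, hc, hx, hxc⟩ := indep_data hY₁c hinf L
  let R : ℝ := ∑ i, ‖x i‖
  have hR : 0 ≤ R := Finset.sum_nonneg fun i _ => norm_nonneg _
  have hxR : ∀ i, ‖x i‖ ≤ R := fun i =>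
    Finset.single_le_sum (f := fun i => ‖x i‖) (fun i _ => norm_nonneg _) (Finset.mem_univ i)
  let D : ℝ := L * R * (3 + 4 * B)
  have hD : 0 ≤ D := by positivity
  refine ⟨min ε₀ (min 1 (c / (D + 1))), by positivity, ?_⟩
  intro Y₁' M' N' Y₂' hY₁'c hM'c hN'c hY₂'c h₁' h₂' gY₁ gM gN gY₂
  set ε := min ε₀ (min 1 (c / (D + 1))) with hε
  have hεpos : 0 < ε := by positivity
  have hM' : M' ≤ Y₂' := le_sup_left.trans h₂'
  have hN' : N' ≤ Y₂' := le_sup_right.trans h₂'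
  obtain ⟨g, hgZ, hg⟩ := hdata ε (min_le_left _ _) M' N' Y₂' hM'c hN'c hM' hN' gM gN gY₂
  have hsurj : ∀ y ∈ Y₂', ∃ e : M' × N' × (Fin K → ℂ), sumMap M' N' g e = y := fun y hy =>
    (hg y hy).imp fun _ h => h.2
  obtain ⟨hF, hFK⟩ := quotFin_of_surj hgZ hM' hN' hsurj
  refine ⟨closed_of_surj hM'c hN'c hY₂'c hM' hN' hgZ hsurj, hF, ?_⟩
  have hεc : ε * D < c := by
    have h1 : ε ≤ c / (D + 1) := (min_le_right _ _).trans (min_le_right _ _)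
    rw [le_div_iff₀ (by positivity)] at h1
    linarith
  have hlow := inter_lower (K := K) x c B R hB hR hx hxR hxc ε hεpos
    ((min_le_right _ _).trans (min_le_left _ _)) hεc hM' hN' gY₁ gM gN g hg
  rw [Fintype.card_fin] at hFK
  unfold tetradIndex eQuotDim
  rw [if_pos hF]
  by_cases hI : QuotFin Y₁' (M' ⊓ N')
  · rw [if_pos hI, ← EReal.coe_sub, EReal.coe_le_coe_iff]
    have h3 := hlow hI
    have h4 : m ≤ (quotFinrank Y₁' (M' ⊓ N') : ℤ) - (quotFinrank (M' ⊔ N') Y₂' : ℤ) := by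
      omega
    exact_mod_cast h4
  · rw [if_neg hI, EReal.top_sub_coe]
    exact le_top
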